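/- Let n be a positive integer and let w∈B_n be fully commutative. Then the RSK shape λ(w^0) of w^0:=[−w_n,…,−w_1,w_1,…,w_n] has three nonzero rows (equivalently, λ(w^0)=(2n−2k,2k−1,1) for some 1≤k≤⌊n/2⌋) if and only if w_1=1, w has exactly one negative entry, and that negative entry is different from −1. Otherwise λ(w^0) has at most two rows, i.e., λ(w^0)=(2n−k,k) for some 0≤k≤n. -/

import Mathlib

open scoped Classical

noncomputable section

namespace Paper

/-- Membership in the hyperoctahedral group `B_n`, realized inside `Equiv.Perm ℤ`:
`w(-i) = -w(i)` and `w` fixes every integer of absolute value larger than `n`. -/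
def InB (n : ℕ) (w : Equiv.Perm ℤ) : Prop :=
  (∀ i : ℤ, w (-i) = - w i) ∧ ∀ i : ℤ, (n : ℤ) < |i| → w i = i

/-- Window entry `w_i` with the convention `w_0 = 0`. -/
def went (w : Equiv.Perm ℤ) (i : ℕ) : ℤ := if i = 0 then 0 else w (i : ℤ)

/-- Stembridge's pattern criterion: `w ∈ B_n` is fully commutative iff there are no
indices `i<j` with `0 > w_i > w_j`, no `i<j<k` with `|w_i| > w_j > w_k`, and no
`i<j<k` with `-w_j > |w_i| > w_k`. -/
def IsFC (n : ℕ) (w : Equiv.Perm ℤ) : Prop :=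
  InB n w ∧
  (¬ ∃ i j : ℕ, 1 ≤ i ∧ i < j ∧ j ≤ n ∧ w (j : ℤ) < w (i : ℤ) ∧ w (i : ℤ) < 0) ∧
  (¬ ∃ i j k : ℕ, 1 ≤ i ∧ i < j ∧ j < k ∧ k ≤ n ∧
      w (j : ℤ) < |w (i : ℤ)| ∧ w (k : ℤ) < w (j : ℤ)) ∧
  (¬ ∃ i j k : ℕ, 1 ≤ i ∧ i < j ∧ j < k ∧ k ≤ n ∧
      |w (i : ℤ)| < - w (j : ℤ) ∧ w (k : ℤ) < |w (i : ℤ)|)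

/-- Membership in `S_n ⊆ B_n`: all window entries positive. -/
def InS (n : ℕ) (w : Equiv.Perm ℤ) : Prop :=
  InB n w ∧ ∀ i : ℕ, 1 ≤ i → i ≤ n → 0 < w (i : ℤ)

/-- 321-avoidance of the window. -/
def Avoids321 (n : ℕ) (w : Equiv.Perm ℤ) : Prop :=
  ¬ ∃ i j k : ℕ, 1 ≤ i ∧ i < j ∧ j < k ∧ k ≤ n ∧
    w (k : ℤ) < w (j : ℤ) ∧ w (j : ℤ) < w (i : ℤ)

/-- Type-B descent set `Des_B(w) = {0 ≤ i ≤ n-1 : w_i > w_{i+1}}`, convention `w_0 = 0`. -/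
def DesB (n : ℕ) (w : Equiv.Perm ℤ) : Finset ℕ :=
  (Finset.range n).filter fun i => went w (i+1) < went w i

/-- Type-A descent set `Des(w) = {1 ≤ i ≤ n-1 : w_i > w_{i+1}}`. -/
def DesA (n : ℕ) (w : Equiv.Perm ℤ) : Finset ℕ :=
  (Finset.Ico 1 n).filter fun i => went w (i+1) < went w i

/-- Last descent: `ldes(w) = max (Des_B(w) ∪ {0})`. -/
def ldes (n : ℕ) (w : Equiv.Perm ℤ) : ℕ := (DesB n w).sup id

/-- `Neg(w) = {1 ≤ i ≤ n : w_i < 0}`. -/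
def NegSet (n : ℕ) (w : Equiv.Perm ℤ) : Finset ℕ :=
  (Finset.Icc 1 n).filter fun i => w (i : ℤ) < 0

/-- Block number `bl(w) = 1 + #{1 ≤ i ≤ n-1 : max(w_1,…,w_i) < min(w_{i+1},…,w_n)}`. -/
def bl (n : ℕ) (w : Equiv.Perm ℤ) : ℕ :=
  1 + ((Finset.Ioo 0 n).filter fun i : ℕ =>
    ∀ j ∈ Finset.Icc 1 i, ∀ k ∈ Finset.Icc (i + 1) n, w ((j : ℕ) : ℤ) < w ((k : ℕ) : ℤ)).card

/-- Chow's type-B fundamental quasi-symmetric function `F^B_J` in variables `x_0,x_1,…`: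
the sum of `x_{i_1} ⋯ x_{i_n}` over `0 ≤ i_1 ≤ ⋯ ≤ i_n` with `i_j < i_{j+1}` for `j ∈ J`,
with the convention `i_0 = 0`. A sequence is encoded by `f : ℕ → ℕ` with `f a = i_a`
for `1 ≤ a ≤ n`, normalized by `f 0 = 0` and `f a = 0` for `a > n`. -/
def FB (R : Type) [CommRing R] (n : ℕ) (J : Finset ℕ) : MvPowerSeries ℕ R :=
  fun m => (Nat.card {f : ℕ → ℕ //
    f 0 = 0 ∧ (∀ a, n < a → f a = 0) ∧
    (∀ a b, a ≤ b → b ≤ n → f a ≤ f b) ∧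
    (∀ j ∈ J, f j < f (j + 1)) ∧
    ∀ v : ℕ, m v = ((Finset.Icc 1 n).filter fun a => f a = v).card} : R)

/-- Gessel's fundamental quasi-symmetric function `F_J` in variables `x_1,x_2,…`. -/
def FA (R : Type) [CommRing R] (n : ℕ) (J : Finset ℕ) : MvPowerSeries ℕ R :=
  fun m => (Nat.card {f : ℕ → ℕ //
    f 0 = 0 ∧ (∀ a, n < a → f a = 0) ∧
    (∀ a, 1 ≤ a → a ≤ n → 1 ≤ f a) ∧
    (∀ a b, 1 ≤ a → a ≤ b → b ≤ n → f a ≤ f b) ∧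
    (∀ j ∈ J, f j < f (j + 1)) ∧
    ∀ v : ℕ, m v = ((Finset.Icc 1 n).filter fun a => f a = v).card} : R)

/-- Complete homogeneous symmetric function `h_m` in the variables `x_s, x_{s+1}, …`. -/
def hSeries (R : Type) [CommRing R] (s m : ℕ) : MvPowerSeries ℕ R :=
  fun μ => if (μ.sum fun _ v => v) = m ∧ ∀ a < s, μ a = 0 then 1 else 0

/-- Number of semistandard Young tableaux of shape `lam` (row lengths `lam 0 ≥ lam 1 ≥ …`),
with all entries `≥ s`, rows weakly increasing, columns strictly increasing,
and content `μ` (the value `v` occurs `μ v` times). Tableaux are normalized to be `0`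
outside the cells of the diagram. -/
def schurCoeff (s : ℕ) (lam : ℕ → ℕ) (μ : ℕ → ℕ) : ℕ :=
  Nat.card {T : ℕ → ℕ → ℕ //
    (∀ i j, j + 1 < lam i → T i j ≤ T i (j + 1)) ∧
    (∀ i j, j < lam (i + 1) → T i j < T (i + 1) j) ∧
    (∀ i j, j < lam i → s ≤ T i j) ∧
    (∀ i j, ¬ j < lam i → T i j = 0) ∧
    ∀ v : ℕ, μ v = Nat.card {p : ℕ × ℕ // p.2 < lam p.1 ∧ T p.1 p.2 = v}}

/-- The Schur function `s_lam` in the variables `x_s, x_{s+1}, …`. -/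
def schurS (R : Type) [CommRing R] (s : ℕ) (lam : ℕ → ℕ) : MvPowerSeries ℕ R :=
  fun m => (schurCoeff s lam (fun v => m v) : R)

/-- The two-row shape `(a, b)` as a row-length function. -/
def twoRow (a b : ℕ) : ℕ → ℕ := fun i => if i = 0 then a else if i = 1 then b else 0

/-- Row-length function of a partition of `k`. -/
def partFun {k : ℕ} (p : Nat.Partition k) : ℕ → ℕ :=
  fun i => ((p.parts.sort (· ≤ ·)).reverse).getD i 0

/-- Conjugate of a row-length function. -/
def conjFun (lam : ℕ → ℕ) : ℕ → ℕ := fun j => Nat.card {i : ℕ // j < lam i}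

/-- Descent set of the standard Young tableau of skew shape `(n,k)/(k)` (resp. of the
bi-tableau of bi-shape `((k),(n-k))`) encoded by the set `S ⊆ {1,…,n}` of entries of the
length-`k` bottom row: `{1 ≤ i ≤ n-1 : i ∉ S, i+1 ∈ S}`. -/
def DesSet (n : ℕ) (S : Finset ℕ) : Finset ℕ :=
  (Finset.Ico 1 n).filter fun i => i ∉ S ∧ i + 1 ∈ S

/-- Last descent of the tableau encoded by `S`. -/
def ldesSet (n : ℕ) (S : Finset ℕ) : ℕ := (DesSet n S).sup id

/-- Type-B descent set of the bi-tableau encoded by `S`: add `0` when `1 ∈ S`. -/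
def DesBSet (n : ℕ) (S : Finset ℕ) : Finset ℕ :=
  if 1 ∈ S then insert 0 (DesSet n S) else DesSet n S

/-- `b_{n,k,j}`: the number of standard Young tableaux of skew shape `(n,k)/(k)`
(encoded by `k`-subsets `S ⊆ {1,…,n}`) with `ldes = n - j`. -/
def bCoeff (n k j : ℕ) : ℕ :=
  ((Finset.Icc 1 n).powerset.filter fun S => S.card = k ∧ ldesSet n S = n - j).card

/-- `a_{n,k,j}`: the number of standard Young tableaux of shape `(n-k,k)` (encoded by
`k`-subsets `S ⊆ {1,…,n}` of second-row entries satisfying the ballot condition)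
with `ldes = n - j`. -/
def aCoeff (n k j : ℕ) : ℕ :=
  ((Finset.Icc 1 n).powerset.filter fun S => S.card = k ∧
    (∀ i ∈ Finset.Icc 1 n, 2 * (S.filter (· ≤ i)).card ≤ i) ∧ ldesSet n S = n - j).card

/-- `e_{n,m,J}`: number of `m`-subsets `S ⊆ {1,…,n}` with `Des_B(S) = J`. -/
def eCoeff (n m : ℕ) (J : Finset ℕ) : ℕ :=
  ((Finset.Icc 1 n).powerset.filter fun S => S.card = m ∧ DesBSet n S = J).card

/-- `d_{n,m,j}`: number of `m`-subsets `S ⊆ {1,…,n}` with `ldes(S) = n - j`. -/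
def dCoeff (n m j : ℕ) : ℕ :=
  ((Finset.Icc 1 n).powerset.filter fun S => S.card = m ∧ ldesSet n S = n - j).card

/-- The palindromic representation `w^0 = [-w_n, …, -w_1, w_1, …, w_n]`,
as a function of the position `p ∈ {1,…,2n}`. -/
def wzero (n : ℕ) (w : Equiv.Perm ℤ) : ℕ → ℤ :=
  fun p => if p ≤ n then - w ((n : ℤ) + 1 - (p : ℤ)) else w ((p : ℤ) - (n : ℤ))

/-- Greene invariant: the maximal total size of a union of `j` increasing subsequences
of `w^0` (a set of positions is such a union iff it admits a coloring by `j` colors with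
each color class increasing). By Greene's theorem this equals `λ_1 + ⋯ + λ_j` for the
RSK shape `λ(w^0)`. -/
def greene (n : ℕ) (w : Equiv.Perm ℤ) (j : ℕ) : ℕ :=
  ((Finset.Icc 1 (2 * n)).powerset.filter fun P =>
    ∃ c : ℕ → Fin j, ∀ p ∈ P, ∀ q ∈ P, p < q → c p = c q →
      wzero n w p < wzero n w q).sup Finset.card

/-- First valley `v(π)`. -/
def firstValley (n : ℕ) (π : Equiv.Perm ℤ) : ℕ :=
  if h : ((DesA n π⁻¹).erase 1).Nonempty then ((DesA n π⁻¹).erase 1).min' h else n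

/-- Order key for the order `-1 <r -2 <r ⋯ <r -n <r 1 <r ⋯ <r n`. -/
def rkey (n : ℕ) (a : ℤ) : ℤ := if a < 0 then -a else a + n

/-- The r-descent set `rDes(w) = {1 ≤ i ≤ n-1 : w_i >r w_{i+1}}`. -/
def rDes (n : ℕ) (w : Equiv.Perm ℤ) : Finset ℕ :=
  (Finset.Ico 1 n).filter fun i : ℕ =>
    rkey n (w (((i : ℕ) + 1 : ℕ) : ℤ)) < rkey n (w ((i : ℕ) : ℤ))

/-- Poirier's type-B quasi-symmetric function `F^P_w(X,Y)`, a power series in the two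
alphabets `x_1,x_2,…` (indexed by `Sum.inl`) and `y_1,y_2,…` (indexed by `Sum.inr`). -/
def FP (n : ℕ) (w : Equiv.Perm ℤ) : MvPowerSeries (ℕ ⊕ ℕ) ℤ :=
  fun m => (Nat.card {f : ℕ → ℕ //
    f 0 = 0 ∧ (∀ a, n < a → f a = 0) ∧
    (∀ a, 1 ≤ a → a ≤ n → 1 ≤ f a) ∧
    (∀ a b, 1 ≤ a → a ≤ b → b ≤ n → f a ≤ f b) ∧
    (∀ j ∈ rDes n w, f j < f (j + 1)) ∧
    (∀ v : ℕ, m (Sum.inl v) =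
      ((Finset.Icc 1 n).filter fun a => f a = v ∧ 0 < w ((a : ℕ) : ℤ)).card) ∧
    ∀ v : ℕ, m (Sum.inr v) =
      ((Finset.Icc 1 n).filter fun a => f a = v ∧ w ((a : ℕ) : ℤ) < 0).card} : ℤ)

/-- The Schur function `s_lam(X)` in the first alphabet `x_1,x_2,…`. -/
def schurX (lam : ℕ → ℕ) : MvPowerSeries (ℕ ⊕ ℕ) ℤ :=
  fun m => if ∀ v, m (Sum.inr v) = 0 then
    (schurCoeff 1 lam fun v => m (Sum.inl v) : ℤ) else 0

/-- The Schur function `s_lam(Y)` in the second alphabet `y_1,y_2,…`. -/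
def schurY (lam : ℕ → ℕ) : MvPowerSeries (ℕ ⊕ ℕ) ℤ :=
  fun m => if ∀ v, m (Sum.inl v) = 0 then
    (schurCoeff 1 lam fun v => m (Sum.inr v) : ℤ) else 0

/-- Chow type-B Schur-positivity: a nonnegative combination of the products
`s_{λ⁻}(x_1,x_2,…) ⋅ s_{λ⁺}(x_0,x_1,…)` over pairs of partitions of total size `n`. -/
def ChowPos (n : ℕ) (F : MvPowerSeries ℕ ℤ) : Prop :=
  ∃ c : (Σ k : Fin (n + 1), Nat.Partition (k : ℕ) × Nat.Partition (n - (k : ℕ))) → ℕ,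
    F = ∑ p : (Σ k : Fin (n + 1), Nat.Partition (k : ℕ) × Nat.Partition (n - (k : ℕ))),
      (c p : ℤ) • (schurS ℤ 1 (partFun p.2.1) * schurS ℤ 0 (partFun p.2.2))

lemma InB.map_zero {n : ℕ} {w : Equiv.Perm ℤ} (h : InB n w) : w 0 = 0 := by
  have := h.1 0
  simp only [neg_zero] at this
  omega

lemma InB.ne_zero {n : ℕ} {w : Equiv.Perm ℤ} (h : InB n w) {i : ℤ} (hi : i ≠ 0) : w i ≠ 0 :=
  fun h0 => hi (w.injective (h0.trans h.map_zero.symm))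

lemma IsFC.le_of_neg {n : ℕ} {w : Equiv.Perm ℤ} (h : IsFC n w) {i j : ℤ} (hi : 1 ≤ i)
    (hij : i < j) (hj : j ≤ n) (h0 : w i < 0) : w i ≤ w j := by
  lift i to ℕ using by omega
  lift j to ℕ using by omega
  by_contra! hlt
  exact h.2.1 ⟨i, j, by omega, by omega, by omega, hlt, h0⟩

lemma IsFC.le_of_lt_abs {n : ℕ} {w : Equiv.Perm ℤ} (h : IsFC n w) {i j k : ℤ} (hi : 1 ≤ i)
    (hij : i < j) (hjk : j < k) (hk : k ≤ n) (h0 : w j < |w i|) : w j ≤ w k := by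
  lift i to ℕ using by omega
  lift j to ℕ using by omega
  lift k to ℕ using by omega
  by_contra! hlt
  exact h.2.2.1 ⟨i, j, k, by omega, by omega, by omega, by omega, h0, hlt⟩

lemma IsFC.abs_le_of_abs_lt {n : ℕ} {w : Equiv.Perm ℤ} (h : IsFC n w) {i j k : ℤ} (hi : 1 ≤ i)
    (hij : i < j) (hjk : j < k) (hk : k ≤ n) (h0 : |w i| < -w j) : |w i| ≤ w k := by
  lift i to ℕ using by omega
  lift j to ℕ using by omega
  lift k to ℕ using by omega
  by_contra! hlt
  exact h.2.2.2 ⟨i, j, k, by omega, by omega, by omega, by omega, h0, hlt⟩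

/-- In a fully commutative `w`, a decreasing triple whose middle position is positive comes from
a positive entry followed by a negative entry of larger absolute value. -/
lemma IsFC.exists_of_triple_of_pos {n : ℕ} {w : Equiv.Perm ℤ} (h : IsFC n w) {i j k : ℤ}
    (hi : -(n : ℤ) ≤ i) (hi0 : i ≠ 0) (hij : i < j) (hj0 : 0 < j) (hjk : j < k) (hk : k ≤ n)
    (h1 : w j < w i) (h2 : w k < w j) : 0 < w j ∧ w k < -w j := by
  rcases lt_or_gt_of_ne hi0 with hneg | hpos
  · obtain ⟨a, rfl⟩ : ∃ a, i = -a := ⟨-i, by ring⟩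
    rw [h.1.1] at h1
    have hj : w j ≠ 0 := h.1.ne_zero (by omega)
    rcases lt_trichotomy a j with haj | rfl | haj
    · have := h.le_of_lt_abs (i := a) (by omega) haj hjk hk
        (h1.trans_le (neg_le_abs _))
      omega
    · have := h.le_of_neg (by omega) hjk hk (by omega)
      omega
    · have hjpos : 0 < w j := by
        by_contra! hle
        have := h.le_of_neg (i := j) (by omega) hjk hk (by omega)
        omega
      refine ⟨hjpos, ?_⟩
      have habs : |w j| = w j := abs_of_pos hjpos
      rcases lt_trichotomy a k with hak | rfl | hak
      · have := h.abs_le_of_abs_lt (i := j) (by omega) haj hak hk (by omega)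
        omega
      · omega
      · have h3 := h.le_of_lt_abs (i := j) (by omega) hjk hak (by omega) (by omega)
        omega
  · have := h.le_of_lt_abs (i := i) (by omega) hij hjk hk (h1.trans_le (le_abs_self _))
    omega

/-- In a fully commutative `w`, a decreasing triple of `w^0` comes from a positive entry followed
by a negative entry of larger absolute value. -/
lemma IsFC.exists_of_triple {n : ℕ} {w : Equiv.Perm ℤ} (h : IsFC n w) {i j k : ℤ}
    (hi : -(n : ℤ) ≤ i) (hi0 : i ≠ 0) (hj0 : j ≠ 0) (hk0 : k ≠ 0) (hij : i < j) (hjk : j < k)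
    (hk : k ≤ n) (h1 : w j < w i) (h2 : w k < w j) :
    ∃ a b : ℤ, 1 ≤ a ∧ a < b ∧ b ≤ n ∧ 0 < w a ∧ w b < -w a := by
  rcases lt_or_gt_of_ne hj0 with hneg | hpos
  · refine ⟨-j, -i, by omega, by omega, by omega, ?_⟩
    refine h.exists_of_triple_of_pos (i := -k) (by omega) (by omega) (by omega) (by omega)
      (by omega) (by omega) ?_ ?_ <;> simp only [h.1.1] <;> omega
  · exact ⟨j, k, by omega, hjk, hk, h.exists_of_triple_of_pos hi hi0 hij hpos hjk hk h1 h2⟩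

lemma IsFC.eq_of_neg_of_lt_neg {n : ℕ} {w : Equiv.Perm ℤ} (h : IsFC n w) {a b c : ℤ}
    (ha : 1 ≤ a) (hab : a < b) (hb : b ≤ n) (hpos : 0 < w a) (hlt : w b < -w a)
    (hc : 1 ≤ c) (hcn : c ≤ n) (hcneg : w c < 0) : c = b := by
  have habs : |w a| = w a := abs_of_pos hpos
  rcases lt_trichotomy c b with hcb | rfl | hcb
  · exfalso
    have h1 := h.le_of_neg hc hcb hb hcneg
    rcases lt_trichotomy a c with hac | rfl | hac
    · have := h.abs_le_of_abs_lt ha hac hcb hb (by omega)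
      omega
    · omega
    · have := h.le_of_lt_abs hc hac hab hb (by rw [abs_of_neg hcneg]; omega)
      omega
  · rfl
  · have := h.abs_le_of_abs_lt ha hab hcb hcn (by omega)
    omega

lemma IsFC.map_one_of_lt_neg {n : ℕ} {w : Equiv.Perm ℤ} (h : IsFC n w) {a b : ℤ}
    (ha : 1 ≤ a) (hab : a < b) (hb : b ≤ n) (hpos : 0 < w a) (hlt : w b < -w a) : w 1 = 1 := by
  obtain ⟨e, he⟩ := w.surjective 1
  have hen : |e| ≤ n := by
    by_contra! hgt
    have := h.1.2 e hgt
    rw [this.symm.trans he, abs_one] at hgt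
    omega
  rw [abs_le] at hen
  have he0 : e ≠ 0 := by
    rintro rfl
    rw [h.1.map_zero] at he
    omega
  have hepos : 0 < e := by
    by_contra! hle
    have hm : w (-e) = -1 := by rw [h.1.1, he]
    have := h.eq_of_neg_of_lt_neg ha hab hb hpos hlt (c := -e) (by omega) (by omega) (by omega)
    rw [this] at hm
    omega
  by_contra hne
  have he1 : e ≠ 1 := by
    rintro rfl
    exact hne he
  have habs : 1 < |w 1| := by
    have h0 : w 1 ≠ 0 := h.1.ne_zero one_ne_zero
    have h1 : w 1 ≠ -1 := by
      intro h1
      have h2 : w (-e) = w 1 := by rw [h.1.1, he, h1]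
      have := w.injective h2
      omega
    rcases abs_cases (w 1) with h | h <;> omega
  rcases lt_trichotomy e b with heb | rfl | heb
  · have := h.le_of_lt_abs le_rfl (j := e) (by omega) heb hb (by omega)
    omega
  · omega
  · have h1 : w a ≠ 1 := by
      intro h1
      have := w.injective (h1.trans he.symm)
      omega
    have h2 : |w a| = w a := abs_of_pos hpos
    have := h.abs_le_of_abs_lt ha hab heb (by omega) (by omega)
    omega

/-- The signed index of position `p` in the palindromic representation. -/
def signedIndex (n p : ℕ) : ℤ := if p ≤ n then (p : ℤ) - n - 1 else (p : ℤ) - n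

lemma InB.wzero_eq {n : ℕ} {w : Equiv.Perm ℤ} (h : InB n w) (p : ℕ) :
    wzero n w p = w (signedIndex n p) := by
  unfold wzero signedIndex
  split_ifs with hp
  · rw [← h.1]
    congr 1
    ring
  · rfl

lemma signedIndex_lt {n p q : ℕ} (h : p < q) : signedIndex n p < signedIndex n q := by
  unfold signedIndex
  split_ifs <;> omega

lemma signedIndex_ne_zero (n p : ℕ) : signedIndex n p ≠ 0 := by
  unfold signedIndex
  split_ifs <;> omega

lemma neg_le_signedIndex {n p : ℕ} (h : 1 ≤ p) : -(n : ℤ) ≤ signedIndex n p := by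
  unfold signedIndex
  split_ifs <;> omega

lemma signedIndex_le {n p : ℕ} (h : p ≤ 2 * n) : signedIndex n p ≤ n := by
  unfold signedIndex
  split_ifs <;> omega

lemma InB.wzero_injective {n : ℕ} {w : Equiv.Perm ℤ} (h : InB n w) :
    Function.Injective (wzero n w) := by
  intro p q hpq
  rw [h.wzero_eq, h.wzero_eq] at hpq
  have := w.injective hpq
  rcases lt_trichotomy p q with hlt | heq | hlt
  · exact absurd this (signedIndex_lt hlt).ne
  · exact heq
  · exact absurd this (signedIndex_lt hlt).ne'

/-- A finite set of positions without decreasing triples is a union of two increasing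
subsequences. -/
lemma exists_two_coloring {f : ℕ → ℤ} (hf : Function.Injective f) (P : Finset ℕ)
    (hP : ∀ p ∈ P, ∀ q ∈ P, ∀ r ∈ P, p < q → q < r → f q < f p → f q ≤ f r) :
    ∃ c : ℕ → Fin 2, ∀ p ∈ P, ∀ q ∈ P, p < q → c p = c q → f p < f q := by
  refine ⟨fun p => if ∃ q ∈ P, q < p ∧ f p < f q then 1 else 0, fun p hp q hq hpq hc => ?_⟩
  by_contra! hle
  have hlt : f q < f p := lt_of_le_of_ne hle fun e => hpq.ne' (hf e)
  have hq1 : ∃ r ∈ P, r < q ∧ f q < f r := ⟨p, hp, hpq, hlt⟩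
  simp only [if_pos hq1] at hc
  split_ifs at hc with hp1
  · obtain ⟨r, hr, hrp, hfr⟩ := hp1
    exact absurd (hP r hr p hp q hq hrp hpq hfr) (not_le.2 hlt)
  · simp at hc

lemma greene_le (n : ℕ) (w : Equiv.Perm ℤ) (j : ℕ) : greene n w j ≤ 2 * n := by
  refine Finset.sup_le fun P hP => ?_
  simp only [Finset.mem_filter, Finset.mem_powerset] at hP
  simpa using Finset.card_le_card hP.1

lemma card_le_greene {n j : ℕ} {w : Equiv.Perm ℤ} {P : Finset ℕ} (hP : P ⊆ Finset.Icc 1 (2 * n))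
    (c : ℕ → Fin j) (hc : ∀ p ∈ P, ∀ q ∈ P, p < q → c p = c q → wzero n w p < wzero n w q) :
    P.card ≤ greene n w j := by
  refine Finset.le_sup (f := Finset.card) ?_
  simp only [Finset.mem_filter, Finset.mem_powerset]
  exact ⟨hP, c, hc⟩

lemma card_le_greene_one {n : ℕ} {w : Equiv.Perm ℤ} {P : Finset ℕ}
    (hP : P ⊆ Finset.Icc 1 (2 * n)) (hc : StrictMonoOn (wzero n w) P) : P.card ≤ greene n w 1 :=
  card_le_greene hP (fun _ => 0) fun _ hp _ hq hpq _ => hc hp hq hpq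

lemma exists_card_eq_greene (n : ℕ) (w : Equiv.Perm ℤ) {j : ℕ} (hj : 0 < j) :
    ∃ P ⊆ Finset.Icc 1 (2 * n), P.card = greene n w j ∧ ∃ c : ℕ → Fin j,
      ∀ p ∈ P, ∀ q ∈ P, p < q → c p = c q → wzero n w p < wzero n w q := by
  have hne : ((Finset.Icc 1 (2 * n)).powerset.filter fun P => ∃ c : ℕ → Fin j,
      ∀ p ∈ P, ∀ q ∈ P, p < q → c p = c q → wzero n w p < wzero n w q).Nonempty :=
    ⟨∅, by
      simp only [Finset.mem_filter, Finset.empty_mem_powerset, true_and]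
      exact ⟨fun _ => ⟨0, hj⟩, by simp⟩⟩
  obtain ⟨P, hP, he⟩ := Finset.exists_mem_eq_sup _ hne Finset.card
  simp only [Finset.mem_filter, Finset.mem_powerset] at hP
  exact ⟨P, hP.1, he.symm, hP.2⟩

lemma greene_two_le (n : ℕ) (w : Equiv.Perm ℤ) : greene n w 2 ≤ 2 * greene n w 1 := by
  obtain ⟨P, hP, hcard, c, hc⟩ := exists_card_eq_greene n w two_pos
  have key : ∀ a : Fin 2, (P.filter fun p => c p = a).card ≤ greene n w 1 := by
    intro a
    refine card_le_greene_one ((Finset.filter_subset _ _).trans hP) ?_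
    intro p hp q hq hpq
    simp only [Finset.coe_filter, Set.mem_ofPred_eq] at hp hq
    exact hc p hp.1 q hq.1 hpq (hp.2.trans hq.2.symm)
  have hsum := Finset.card_eq_sum_card_fiberwise (f := c) (s := P) (t := Finset.univ)
    (fun _ _ => Finset.mem_coe.2 (Finset.mem_univ _))
  rw [Fin.sum_univ_two] at hsum
  have h0 := key 0
  have h1 := key 1
  omega

/-- The left-peak condition of the theorem, with the negative entry singled out. -/
lemma leftPeak_iff {n : ℕ} {w : Equiv.Perm ℤ} :
    (w (1 : ℤ) = 1 ∧ (NegSet n w).card = 1 ∧ ∀ i ∈ NegSet n w, w ((i : ℕ) : ℤ) ≠ -1) ↔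
      w 1 = 1 ∧ ∃ m : ℕ, 1 ≤ m ∧ m ≤ n ∧ w (m : ℤ) < -1 ∧
        ∀ i : ℕ, 1 ≤ i → i ≤ n → w (i : ℤ) < 0 → i = m := by
  refine and_congr_right fun _ => ⟨?_, ?_⟩
  · rintro ⟨hcard, hne⟩
    obtain ⟨m, hm⟩ := Finset.card_eq_one.1 hcard
    have hmem : ∀ i, i ∈ NegSet n w ↔ i = m := by simp [hm]
    have hmm := (hmem m).2 rfl
    have hm1 := hne m hmm
    simp only [NegSet, Finset.mem_filter, Finset.mem_Icc] at hmem hmm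
    exact ⟨m, hmm.1.1, hmm.1.2, by omega, fun i h1 h2 h3 => (hmem i).1 ⟨⟨h1, h2⟩, h3⟩⟩
  · rintro ⟨m, h1, h2, h3, h4⟩
    have hm : NegSet n w = {m} := by
      ext i
      simp only [NegSet, Finset.mem_filter, Finset.mem_Icc, Finset.mem_singleton]
      constructor
      · rintro ⟨⟨h5, h6⟩, h7⟩
        exact h4 i h5 h6 h7
      · rintro rfl
        exact ⟨⟨h1, h2⟩, by omega⟩
    rw [hm]
    refine ⟨rfl, fun i hi => ?_⟩
    rw [Finset.mem_singleton.1 hi]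
    omega

lemma IsFC.greene_two_eq {n : ℕ} {w : Equiv.Perm ℤ} (h : IsFC n w)
    (hw : ¬ (w (1 : ℤ) = 1 ∧ (NegSet n w).card = 1 ∧
      ∀ i ∈ NegSet n w, w ((i : ℕ) : ℤ) ≠ -1)) : greene n w 2 = 2 * n := by
  refine (greene_le n w 2).antisymm ?_
  rw [leftPeak_iff] at hw
  obtain ⟨c, hc⟩ := exists_two_coloring h.1.wzero_injective (Finset.Icc 1 (2 * n)) (by
    intro p hp q hq r hr hpq hqr hlt
    by_contra! hlt'
    simp only [h.1.wzero_eq, Finset.mem_Icc] at *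
    obtain ⟨a, b, ha, hab, hb, hpos, hneg⟩ := h.exists_of_triple (neg_le_signedIndex hp.1)
      (signedIndex_ne_zero _ _) (signedIndex_ne_zero _ _) (signedIndex_ne_zero _ _)
      (signedIndex_lt hpq) (signedIndex_lt hqr) (signedIndex_le hr.2) hlt hlt'
    refine hw ⟨h.map_one_of_lt_neg ha hab hb hpos hneg, ?_⟩
    lift b to ℕ using by omega
    refine ⟨b, by omega, by omega, by omega, fun i h1 h2 h3 => ?_⟩
    have := h.eq_of_neg_of_lt_neg ha hab hb hpos hneg (c := i) (by omega) (by omega) h3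
    omega)
  simpa using card_le_greene subset_rfl c hc

section LeftPeak

variable {n m : ℕ} {w : Equiv.Perm ℤ}

/-- Away from index `-m`, a left-peak fully commutative `w` with negative entry `w_m` has no
decreasing triple. -/
lemma IsFC.le_of_leftPeak (h : IsFC n w) (hm1 : 1 ≤ m)
    (hneg : ∀ i : ℤ, 1 ≤ i → i ≤ n → w i < 0 → i = m) {i j k : ℤ}
    (hi : -(n : ℤ) ≤ i) (hi0 : i ≠ 0) (hj0 : j ≠ 0) (hk0 : k ≠ 0) (hij : i < j) (hjk : j < k)
    (hk : k ≤ n) (him : i ≠ -m) (hjm : j ≠ -m) (h1 : w j < w i) : w j ≤ w k := by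
  by_contra! h2
  have hsign : ∀ l : ℤ, -(n : ℤ) ≤ l → l < 0 → l ≠ -m → w l < 0 := by
    intro l hl hl0 hlm
    by_contra! hle
    have h0 := h.1.ne_zero hl0.ne
    have := hneg (-l) (by omega) (by omega) (by rw [h.1.1]; omega)
    omega
  rcases lt_or_gt_of_ne hj0 with hj | hj
  · have hwi := hsign i hi (by omega) him
    have hwj := hsign j (by omega) hj hjm
    rcases lt_or_gt_of_ne hk0 with hk' | hk'
    · have := h.le_of_lt_abs (i := -k) (j := -j) (k := -i) (by omega) (by omega) (by omega)
        (by omega) (by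
          have := h.1.1 k
          have := h.1.1 j
          rcases abs_cases (w (-k)) with h' | h' <;> omega)
      simp only [h.1.1] at this
      omega
    · obtain rfl := hneg k hk' hk (by omega)
      have e1 := h.1.1 i
      have e2 := h.1.1 j
      rcases lt_trichotomy (-j) m with hjm' | hjm' | hjm'
      · rcases lt_trichotomy (-i) m with him' | him' | him'
        · have := h.le_of_lt_abs (i := -j) (j := -i) (k := m) (by omega) (by omega) (by omega)
            (by omega) (by rw [h.1.1, h.1.1, abs_of_pos] <;> omega)
          omega
        · omega
        · have := h.abs_le_of_abs_lt (i := -j) (j := m) (k := -i) (by omega) (by omega)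
            (by omega) (by omega) (by rw [h.1.1, abs_of_pos] <;> omega)
          rw [h.1.1, abs_of_pos] at this <;> omega
      · omega
      · have := h.le_of_lt_abs (i := m) (j := -j) (k := -i) (by omega) (by omega) (by omega)
          (by omega) (by rw [h.1.1, abs_of_neg] <;> omega)
        omega
  · obtain ⟨hwj, hwk⟩ := h.exists_of_triple_of_pos hi hi0 hij hj hjk hk h1 h2
    rcases lt_or_gt_of_ne hi0 with hi' | hi'
    · have := hsign i hi hi' him
      omega
    · have := h.le_of_lt_abs (i := i) (by omega) hij hjk hk (h1.trans_le (le_abs_self _))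
      omega

lemma signedIndex_eq_neg {p : ℕ} (hmn : m ≤ n) (hm1 : 1 ≤ m) :
    signedIndex n p = -m ↔ p = n + 1 - m := by
  unfold signedIndex
  split_ifs <;> omega

lemma InB.wzero_add (h : InB n w) {i : ℕ} (hi : 1 ≤ i) : wzero n w (n + i) = w i := by
  rw [h.wzero_eq, signedIndex, if_neg (by omega)]
  congr 1
  omega

lemma InB.wzero_sub (h : InB n w) {i : ℕ} (hi : 1 ≤ i) (hin : i ≤ n) :
    wzero n w (n + 1 - i) = -w i := by
  rw [h.wzero_eq, signedIndex, if_pos (by omega), ← h.1]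
  congr 1
  omega

lemma IsFC.exists_two_coloring_of_leftPeak (h : IsFC n w) (hm1 : 1 ≤ m) (hmn : m ≤ n)
    (hneg : ∀ i : ℤ, 1 ≤ i → i ≤ n → w i < 0 → i = m) :
    ∃ c : ℕ → Fin 2, ∀ p ∈ (Finset.Icc 1 (2 * n)).erase (n + 1 - m),
      ∀ q ∈ (Finset.Icc 1 (2 * n)).erase (n + 1 - m), p < q → c p = c q →
        wzero n w p < wzero n w q := by
  refine exists_two_coloring h.1.wzero_injective _ fun p hp q hq r hr hpq hqr hlt => ?_
  simp only [h.1.wzero_eq, Finset.mem_erase, Finset.mem_Icc] at *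
  exact h.le_of_leftPeak hm1 hneg (neg_le_signedIndex hp.2.1)
    (signedIndex_ne_zero _ _) (signedIndex_ne_zero _ _) (signedIndex_ne_zero _ _)
    (signedIndex_lt hpq) (signedIndex_lt hqr) (signedIndex_le hr.2.2)
    ((signedIndex_eq_neg hmn hm1).not.2 hp.1) ((signedIndex_eq_neg hmn hm1).not.2 hq.1) hlt

lemma IsFC.greene_three_of_leftPeak (h : IsFC n w) (hm1 : 1 ≤ m) (hmn : m ≤ n)
    (hneg : ∀ i : ℤ, 1 ≤ i → i ≤ n → w i < 0 → i = m) : greene n w 3 = 2 * n := by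
  refine (greene_le n w 3).antisymm ?_
  obtain ⟨c, hc⟩ := h.exists_two_coloring_of_leftPeak hm1 hmn hneg
  have := card_le_greene (w := w) (subset_refl (Finset.Icc 1 (2 * n)))
    (fun p => if p = n + 1 - m then Fin.last 2 else (c p).castSucc) (by
      intro p hp q hq hpq he
      split_ifs at he with h1 h2 h2
      · omega
      · exact absurd he.symm (Fin.castSucc_lt_last _).ne
      · exact absurd he (Fin.castSucc_lt_last _).ne
      · exact hc p (Finset.mem_erase.2 ⟨h1, hp⟩) q (Finset.mem_erase.2 ⟨h2, hq⟩) hpq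
          (Fin.castSucc_injective _ he))
  simpa using this

lemma IsFC.greene_two_of_leftPeak (h : IsFC n w) (hw1 : w 1 = 1) (hm1 : 1 ≤ m) (hmn : m ≤ n)
    (hwm : w m < -1) (hneg : ∀ i : ℤ, 1 ≤ i → i ≤ n → w i < 0 → i = m) :
    greene n w 2 = 2 * n - 1 := by
  have hm2 : m ≠ 1 := by
    rintro rfl
    simp only [Nat.cast_one] at hwm
    omega
  refine le_antisymm ?_ ?_
  · by_contra! hlt
    obtain ⟨P, hP, hcard, c, hc⟩ := exists_card_eq_greene n w two_pos
    have hPe : P = Finset.Icc 1 (2 * n) := by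
      refine Finset.eq_of_subset_of_card_le hP ?_
      simp only [Nat.card_Icc]
      omega
    subst hPe
    have e1 := h.1.wzero_sub hm1 hmn
    have e2 := h.1.wzero_add le_rfl
    have e3 := h.1.wzero_add hm1
    simp only [Nat.cast_one, hw1] at e2
    have ha := hc (n + 1 - m) (by simp; omega) (n + 1) (by simp; omega) (by omega)
    have hb := hc (n + 1) (by simp; omega) (n + m) (by simp; omega) (by omega)
    have hab := hc (n + 1 - m) (by simp; omega) (n + m) (by simp; omega) (by omega)
    rw [e1, e2] at ha
    rw [e2, e3] at hb
    rw [e1, e3] at hab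
    have ha' : c (n + 1 - m) ≠ c (n + 1) := fun e => by
      have := ha e
      omega
    have hb' : c (n + 1) ≠ c (n + m) := fun e => by
      have := hb e
      omega
    have hab' : c (n + 1 - m) ≠ c (n + m) := fun e => by
      have := hab e
      omega
    omega
  · obtain ⟨c, hc⟩ := h.exists_two_coloring_of_leftPeak hm1 hmn hneg
    have := card_le_greene (Finset.erase_subset _ _) c hc
    rw [Finset.card_erase_of_mem (by simp; omega), Nat.card_Icc] at this
    omega

/-- A longest increasing subsequence can be chosen symmetric, so its length is even. -/
lemma IsFC.exists_greene_one_of_leftPeak (h : IsFC n w) (hw1 : w 1 = 1) (hm1 : 1 ≤ m)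
    (hmn : m ≤ n) (hwm : w m < -1) (hneg : ∀ i : ℤ, 1 ≤ i → i ≤ n → w i < 0 → i = m) :
    ∃ L < n, greene n w 1 = 2 * L := by
  have hm2 : m ≠ 1 := by
    rintro rfl
    simp only [Nat.cast_one] at hwm
    omega
  have hpos : ∀ i ∈ (Finset.Icc 1 n).erase m, 0 < w (i : ℤ) := by
    intro i hi
    simp only [Finset.mem_erase, Finset.mem_Icc] at hi
    by_contra! hle
    have h0 := h.1.ne_zero (i := i) (by omega)
    have := hneg i (by omega) (by omega) (by omega)
    omega
  have hge : ∀ i ∈ (Finset.Icc 1 n).erase m, i ≠ 1 → 1 < w (i : ℤ) := by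
    intro i hi hi1
    have h0 := hpos i hi
    have h1 : w (i : ℤ) ≠ w 1 := fun e => by
      have := w.injective e
      omega
    omega
  set S := ((Finset.Icc 1 n).erase m).powerset.filter
    fun Q : Finset ℕ => StrictMonoOn (fun i : ℕ => w (i : ℤ)) Q with hS
  have hle : ∀ Q : Finset ℕ, Q ⊆ (Finset.Icc 1 n).erase m →
      StrictMonoOn (fun i : ℕ => w (i : ℤ)) Q → Q.card ≤ S.sup Finset.card := by
    intro Q hQ hmono
    refine Finset.le_sup (f := Finset.card) ?_
    rw [hS, Finset.mem_filter, Finset.mem_powerset]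
    exact ⟨hQ, hmono⟩
  obtain ⟨Q, hQS, hQcard⟩ := Finset.exists_mem_eq_sup S
    ⟨∅, by simp [hS, StrictMonoOn]⟩ Finset.card
  rw [hS, Finset.mem_filter, Finset.mem_powerset] at hQS
  obtain ⟨hQ, hQmono⟩ := hQS
  refine ⟨S.sup Finset.card, ?_, le_antisymm ?_ ?_⟩
  · rw [hQcard]
    have := Finset.card_le_card hQ
    rw [Finset.card_erase_of_mem (by simp; omega), Nat.card_Icc] at this
    omega
  · obtain ⟨P, hP, hPcard, c, hc⟩ := exists_card_eq_greene n w one_pos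
    replace hc : ∀ p ∈ P, ∀ q ∈ P, p < q → wzero n w p < wzero n w q :=
      fun p hp q hq hpq => hc p hp q hq hpq (Subsingleton.elim _ _)
    rw [← hPcard]
    set A := ((Finset.Icc 1 n).erase m).filter fun i => n + i ∈ P with hA
    set B := ((Finset.Icc 1 n).erase m).filter fun i => n + 1 - i ∈ P with hB
    set C := P.filter fun p => p = n + m ∨ p = n + 1 - m with hC
    have hAmono : StrictMonoOn (fun i : ℕ => w (i : ℤ)) A := by
      intro i hi j hj hij
      simp only [hA, Finset.coe_filter, Set.mem_ofPred_eq, Finset.mem_erase,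
        Finset.mem_Icc] at hi hj
      have := hc _ hi.2 _ hj.2 (by omega)
      rwa [h.1.wzero_add hi.1.2.1, h.1.wzero_add hj.1.2.1] at this
    have hBmono : StrictMonoOn (fun i : ℕ => w (i : ℤ)) B := by
      intro i hi j hj hij
      simp only [hB, Finset.coe_filter, Set.mem_ofPred_eq, Finset.mem_erase,
        Finset.mem_Icc] at hi hj
      have := hc _ hj.2 _ hi.2 (by omega)
      rw [h.1.wzero_sub hi.1.2.1 hi.1.2.2, h.1.wzero_sub hj.1.2.1 hj.1.2.2] at this
      simpa using this
    have hAle := hle A (Finset.filter_subset _ _) hAmono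
    have hBle := hle B (Finset.filter_subset _ _) hBmono
    have hcover : P.card ≤ A.card + B.card + C.card := by
      have hsub : P ⊆ (A.image (n + ·) ∪ B.image (n + 1 - ·)) ∪ C := by
        intro p hp
        have hp' := Finset.mem_Icc.1 (hP hp)
        simp only [hA, hB, hC, Finset.mem_union, Finset.mem_image, Finset.mem_filter,
          Finset.mem_erase, Finset.mem_Icc]
        by_cases hpm : p = n + m ∨ p = n + 1 - m
        · exact Or.inr ⟨hp, hpm⟩
        · rcases le_or_gt p n with hpn | hpn
          · have e : n + 1 - (n + 1 - p) = p := by omega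
            exact Or.inl (Or.inr ⟨n + 1 - p, ⟨by omega, by rwa [e]⟩, e⟩)
          · have e : n + (p - n) = p := by omega
            exact Or.inl (Or.inl ⟨p - n, ⟨by omega, by rwa [e]⟩, e⟩)
      refine (Finset.card_le_card hsub).trans ((Finset.card_union_le _ _).trans ?_)
      have h1 := Finset.card_union_le (A.image (n + ·)) (B.image (n + 1 - ·))
      have h2 := Finset.card_image_le (s := A) (f := (n + ·))
      have h3 := Finset.card_image_le (s := B) (f := (n + 1 - ·))
      omega
    rcases C.eq_empty_or_nonempty with hCe | ⟨p, hpC⟩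
    · rw [hCe, Finset.card_empty] at hcover
      omega
    have e1 := h.1.wzero_sub hm1 hmn
    have e2 := h.1.wzero_add hm1
    have e3 := h.1.wzero_add le_rfl
    have e4 := h.1.wzero_sub le_rfl (by omega)
    simp only [Nat.cast_one, hw1] at e3 e4
    have hboth : ¬ (n + m ∈ P ∧ n + 1 - m ∈ P) := by
      rintro ⟨h1, h2⟩
      have := hc _ h2 _ h1 (by omega)
      omega
    have hCcard : C.card ≤ 1 := by
      refine Finset.card_le_one.2 fun a ha b hb => ?_
      simp only [hC, Finset.mem_filter] at ha hb
      obtain ⟨ha, rfl | rfl⟩ := ha <;> obtain ⟨hb, rfl | rfl⟩ := hb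
      · rfl
      · exact absurd ⟨ha, hb⟩ hboth
      · exact absurd ⟨hb, ha⟩ hboth
      · rfl
    simp only [hC, Finset.mem_filter] at hpC
    have h1A : 1 ∉ A := by
      intro h1
      simp only [hA, Finset.mem_filter] at h1
      obtain ⟨hp, rfl | rfl⟩ := hpC
      · have := hc _ h1.2 _ hp (by omega)
        omega
      · have := hc _ hp _ h1.2 (by omega)
        omega
    have h1B : 1 ∉ B := by
      intro h1
      simp only [hB, Finset.mem_filter] at h1
      obtain ⟨hp, rfl | rfl⟩ := hpC
      · have := hc _ h1.2 _ hp (by omega)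
        omega
      · have := hc _ hp _ h1.2 (by omega)
        omega
    have hins : ∀ R : Finset ℕ, R ⊆ (Finset.Icc 1 n).erase m →
        StrictMonoOn (fun i : ℕ => w (i : ℤ)) R → 1 ∉ R → R.card + 1 ≤ S.sup Finset.card := by
      intro R hR hmono h1
      rw [← Finset.card_insert_of_notMem h1]
      refine hle _ (Finset.insert_subset (by simp; omega) hR) ?_
      intro i hi j hj hij
      simp only [Finset.coe_insert, Set.mem_insert_iff, Finset.mem_coe] at hi hj
      rcases hi with rfl | hi <;> rcases hj with rfl | hj
      · omega
      · have := hge j (hR hj) (by omega)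
        simpa [hw1] using this
      · have := hR hi
        simp only [Finset.mem_erase, Finset.mem_Icc] at this
        omega
      · exact hmono hi hj hij
    have hA1 := hins A (Finset.filter_subset _ _) hAmono h1A
    have hB1 := hins B (Finset.filter_subset _ _) hBmono h1B
    omega
  · have hQ' : ∀ i ∈ Q, 1 ≤ i ∧ i ≤ n := fun i hi =>
      Finset.mem_Icc.1 (Finset.mem_of_mem_erase (hQ hi))
    have hdisj : Disjoint (Q.image (n + ·)) (Q.image (n + 1 - ·)) := by
      simp only [Finset.disjoint_left, Finset.mem_image]
      rintro _ ⟨i, hi, rfl⟩ ⟨j, hj, e⟩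
      have := hQ' i hi
      have := hQ' j hj
      omega
    have hcard : (Q.image (n + ·) ∪ Q.image (n + 1 - ·)).card = 2 * Q.card := by
      rw [Finset.card_union_of_disjoint hdisj, Finset.card_image_of_injOn,
        Finset.card_image_of_injOn]
      · omega
      · intro i hi j hj e
        have := hQ' i hi
        have := hQ' j hj
        simp only at e
        omega
      · intro i _ j _ e
        simp only at e
        omega
    rw [hQcard, ← hcard]
    refine card_le_greene_one ?_ ?_
    · intro p hp
      simp only [Finset.mem_union, Finset.mem_image] at hp
      rw [Finset.mem_Icc]
      rcases hp with ⟨i, hi, rfl⟩ | ⟨i, hi, rfl⟩ <;> have := hQ' i hi <;> omega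
    · intro p hp q hq hpq
      simp only [Finset.coe_union, Finset.coe_image, Set.mem_union, Set.mem_image,
        Finset.mem_coe] at hp hq
      rcases hp with ⟨i, hi, rfl⟩ | ⟨i, hi, rfl⟩ <;>
        rcases hq with ⟨j, hj, rfl⟩ | ⟨j, hj, rfl⟩ <;>
        have hi' := hQ' i hi <;> have hj' := hQ' j hj
      · rw [h.1.wzero_add hi'.1, h.1.wzero_add hj'.1]
        exact hQmono hi hj (by omega)
      · omega
      · rw [h.1.wzero_sub hi'.1 hi'.2, h.1.wzero_add hj'.1]
        have := hpos i (hQ hi)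
        have := hpos j (hQ hj)
        omega
      · rw [h.1.wzero_sub hi'.1 hi'.2, h.1.wzero_sub hj'.1 hj'.2]
        have := hQmono hj hi (by omega)
        simpa using this

end LeftPeak

theorem three_row_shape_iff_left_peak (n : ℕ) (hn : 0 < n) (w : Equiv.Perm ℤ)
    (hw : IsFC n w) :
    ((∃ k, 1 ≤ k ∧ 2 * k ≤ n ∧ greene n w 1 = 2 * n - 2 * k ∧
        greene n w 2 = 2 * n - 1 ∧ greene n w 3 = 2 * n) ↔
      (w (1 : ℤ) = 1 ∧ (NegSet n w).card = 1 ∧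
        ∀ i ∈ NegSet n w, w ((i : ℕ) : ℤ) ≠ -1)) ∧
    (¬ (w (1 : ℤ) = 1 ∧ (NegSet n w).card = 1 ∧
        ∀ i ∈ NegSet n w, w ((i : ℕ) : ℤ) ≠ -1) →
      ∃ k ≤ n, greene n w 1 = 2 * n - k ∧ greene n w 2 = 2 * n) := by
  refine ⟨⟨?_, ?_⟩, fun hlp => ?_⟩
  · rintro ⟨k, -, -, -, h2, -⟩
    by_contra hlp
    have := hw.greene_two_eq hlp
    omega
  · intro hlp
    obtain ⟨hw1, m, hm1, hmn, hwm, huniq⟩ := leftPeak_iff.1 hlp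
    have hneg : ∀ i : ℤ, 1 ≤ i → i ≤ n → w i < 0 → i = m := by
      intro i h1 h2 h3
      lift i to ℕ using by omega
      exact_mod_cast huniq i (by omega) (by omega) h3
    obtain ⟨L, hLn, hL⟩ := hw.exists_greene_one_of_leftPeak hw1 hm1 hmn hwm hneg
    have h2 := hw.greene_two_of_leftPeak hw1 hm1 hmn hwm hneg
    have hle := greene_two_le n w
    exact ⟨n - L, by omega, by omega, by omega, h2, hw.greene_three_of_leftPeak hm1 hmn hneg⟩
  · have h2 := hw.greene_two_eq hlp
    have hle := greene_two_le n w
    have hle' := greene_le n w 1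
    exact ⟨2 * n - greene n w 1, by omega, by omega, h2⟩

end Paper
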